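/- Given a matched pair of almost groups (G, J_G) and (M, J_M), the set G × M with multiplication (u,s)(v,t) = (u(s▷v), (s◁v)t), involution (u,s)^i = (s^i ▷ u^i, s^i ◁ u^i), and J = J_G × J_M is an almost group (the doublecross product G ⋈ M). -/

import Mathlib

/-- Data of an almost group: a binary operation, an `i` operation, and a subset `J`. -/
structure AlmostGroupData (G : Type*) where
  mul : G → G → G
  inv : G → G
  J : Set G

/-- The axioms of an almost group (Definition 2.1). -/
structure IsAlmostGroup {G : Type*} (D : AlmostGroupData G) : Prop where
  mul_assoc : ∀ a b c, D.mul (D.mul a b) c = D.mul a (D.mul b c)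
  inv_bijective : Function.Bijective D.inv
  J_mul_closed : ∀ a ∈ D.J, ∀ b ∈ D.J, D.mul a b ∈ D.J
  J_inv_closed : ∀ a ∈ D.J, D.inv a ∈ D.J
  inv_mul : ∀ a b, D.inv (D.mul a b) = D.mul (D.inv b) (D.inv a)
  J_central : ∀ j ∈ D.J, ∀ g, D.mul j g = D.mul g j
  mul_inv_comm : ∀ g, D.mul g (D.inv g) = D.mul (D.inv g) g
  mul_inv_mem : ∀ g, D.mul g (D.inv g) ∈ D.J
  inv_inv : ∀ g, D.inv (D.inv g) = g

/-- Data of a matched pair of almost groups: two almost groups and two actions. -/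
structure MatchedPairData (G M : Type*) where
  DG : AlmostGroupData G
  DM : AlmostGroupData M
  act : M → G → G      -- ▷ : M × G → G
  coact : M → G → M    -- ◁ : M × G → M

/-- The axioms of a matched pair of almost groups (Definition 4.1). -/
structure IsMatchedPair {G M : Type*} (P : MatchedPairData G M) : Prop where
  almostGroup_G : IsAlmostGroup P.DG
  almostGroup_M : IsAlmostGroup P.DM
  coact_mul : ∀ s u v, P.coact s (P.DG.mul u v) = P.coact (P.coact s u) v
  mul_coact : ∀ s t u, P.coact (P.DM.mul s t) u =
      P.DM.mul (P.coact s (P.act t u)) (P.coact t u)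
  mul_act : ∀ s t u, P.act (P.DM.mul s t) u = P.act s (P.act t u)
  act_mul : ∀ s u v, P.act s (P.DG.mul u v) =
      P.DG.mul (P.act s u) (P.act (P.coact s u) v)
  inv_act : ∀ s u, P.act (P.DM.inv (P.coact s u)) (P.DG.inv (P.act s u)) = P.DG.inv u
  inv_coact : ∀ s u, P.coact (P.DM.inv (P.coact s u)) (P.DG.inv (P.act s u)) = P.DM.inv s
  actJM : ∀ j ∈ P.DM.J, ∀ u, P.act j u = u
  coactJM : ∀ j ∈ P.DM.J, ∀ u, P.coact j u = j
  actJG : ∀ s, ∀ j ∈ P.DG.J, P.act s j = j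
  coactJG : ∀ s, ∀ j ∈ P.DG.J, P.coact s j = s

variable {G M : Type*} (P : MatchedPairData G M)

/-- Multiplication on the doublecross product `G ⋈ M`. -/
def dcMul (x y : G × M) : G × M :=
  (P.DG.mul x.1 (P.act x.2 y.1), P.DM.mul (P.coact x.2 y.1) y.2)

/-- The `i` operation on the doublecross product `G ⋈ M`. -/
def dcInv (x : G × M) : G × M :=
  (P.act (P.DM.inv x.2) (P.DG.inv x.1), P.coact (P.DM.inv x.2) (P.DG.inv x.1))

/-- The almost group data of the doublecross product `G ⋈ M`. -/
def dcData : AlmostGroupData (G × M) :=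
  ⟨dcMul P, dcInv P, {p | p.1 ∈ P.DG.J ∧ p.2 ∈ P.DM.J}⟩

/-- The doublecross product `G ⋈ M` of a matched pair of almost groups, with
multiplication `(u,s)(v,t) = (u(s ▷ v), (s ◁ v)t)`, involution
`(u,s)^i = (s^i ▷ u^i, s^i ◁ u^i)` and `J = J_G × J_M`, is an almost group. -/
theorem doublecross_isAlmostGroup (hP : IsMatchedPair P) :
    IsAlmostGroup (dcData P) := by
  have hG := hP.almostGroup_G
  have hM := hP.almostGroup_M
  have hii : ∀ g, dcInv P (dcInv P g) = g := by
    rintro ⟨u, s⟩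
    simp only [dcInv, hP.inv_act, hP.inv_coact, hG.inv_inv, hM.inv_inv]
  have hr : ∀ u s, dcMul P (u, s) (dcInv P (u, s)) =
      (P.DG.mul u (P.DG.inv u), P.DM.mul s (P.DM.inv s)) := by
    intro u s
    simp only [dcMul, dcInv]
    rw [← hP.mul_act, ← hP.mul_coact, hP.actJM _ (hM.mul_inv_mem s),
      hP.coactJM _ (hM.mul_inv_mem s)]
  have hl : ∀ u s, dcMul P (dcInv P (u, s)) (u, s) =
      (P.DG.mul u (P.DG.inv u), P.DM.mul s (P.DM.inv s)) := by
    intro u s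
    simp only [dcMul, dcInv]
    rw [← hP.act_mul, ← hP.coact_mul, ← hG.mul_inv_comm, hP.actJG _ _ (hG.mul_inv_mem u),
      hP.coactJG _ _ (hG.mul_inv_mem u), hM.mul_inv_comm]
  refine
    { mul_assoc := ?_
      inv_bijective := Function.Involutive.bijective hii
      J_mul_closed := ?_
      J_inv_closed := ?_
      inv_mul := ?_
      J_central := ?_
      mul_inv_comm := ?_
      mul_inv_mem := ?_
      inv_inv := hii }
  · rintro ⟨u, s⟩ ⟨v, t⟩ ⟨w, r⟩
    simp only [dcData, dcMul, hP.mul_act, hP.act_mul, hP.coact_mul, hP.mul_coact,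
      hG.mul_assoc, hM.mul_assoc]
  · rintro ⟨j, k⟩ ⟨hj, hk⟩ ⟨j', k'⟩ ⟨hj', hk'⟩
    simp only at hj hk hj' hk'
    simp only [dcData, dcMul, Set.mem_setOf_eq]
    rw [hP.actJM _ hk, hP.coactJM _ hk]
    exact ⟨hG.J_mul_closed _ hj _ hj', hM.J_mul_closed _ hk _ hk'⟩
  · rintro ⟨j, k⟩ ⟨hj, hk⟩
    have hk2 := hM.J_inv_closed _ hk
    have hj2 := hG.J_inv_closed _ hj
    simp only [dcData, dcInv, Set.mem_setOf_eq]
    rw [hP.actJM _ hk2, hP.coactJM _ hk2]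
    exact ⟨hj2, hk2⟩
  · rintro ⟨u, s⟩ ⟨v, t⟩
    simp only [dcData, dcMul, dcInv, hG.inv_mul, hM.inv_mul, hP.mul_act, hP.act_mul,
      hP.coact_mul, hP.mul_coact, hP.inv_act, hP.inv_coact]
  · rintro ⟨j, k⟩ ⟨hj, hk⟩ ⟨u, s⟩
    simp only at hj hk
    simp only [dcData, dcMul]
    rw [hP.actJM _ hk, hP.coactJM _ hk, hP.actJG _ _ hj, hP.coactJG _ _ hj,
      hG.J_central _ hj, hM.J_central _ hk]
  · rintro ⟨u, s⟩
    exact (hr u s).trans (hl u s).symm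
  · rintro ⟨u, s⟩
    have h := hr u s
    change dcMul P (u, s) (dcInv P (u, s)) ∈ (dcData P).J
    rw [h]
    exact ⟨hG.mul_inv_mem u, hM.mul_inv_mem s⟩
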